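/- For all partial ballots σ, τ on m candidates, the path-metric distance between σ and τ in the shortcut ballot graph 𝒢_m^+ equals d_B(σ,τ). -/

import Mathlib

/-- `σ` is the rank function of a (possibly partial) ballot on `m` candidates, under the
pessimistic convention: the `k` listed candidates get their positions `1,…,k` and all
unlisted candidates get rank `m`.  (A ballot listing `m-1` candidates has the same rank
function as its unique completion, realizing the identification of such ballots.) -/
def IsBallot (m : ℕ) (σ : Fin m → ℕ) : Prop :=
  (∀ i, 1 ≤ σ i ∧ σ i ≤ m) ∧
  (∀ i i', σ i < m → σ i = σ i' → i = i') ∧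
  (∀ i j, 1 ≤ j → j ≤ σ i → σ i < m → ∃ i', σ i' = j)

/-- A partial ballot on `m` candidates, encoded by its rank function. -/
def Ballot (m : ℕ) : Type := {σ : Fin m → ℕ // IsBallot m σ}

/-- The Borda embedding: candidate `i` receives `m - σ i` Borda points. -/
noncomputable def bordaEmb (m : ℕ) (σ : Fin m → ℕ) (i : Fin m) : ℝ :=
  (m : ℝ) - (σ i : ℝ)

/-- The Borda distance: half the `L¹` distance between Borda embeddings. -/
noncomputable def dB (m : ℕ) (σ τ : Fin m → ℕ) : ℝ :=
  (1 / 2) * ∑ i, |bordaEmb m σ i - bordaEmb m τ i|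

/-- The head-to-head coordinate of the pair `(i,j)`: `+1` if `σ i > σ j`, `0` on a tie,
`-1` if `σ i < σ j`. -/
noncomputable def hcoord {m : ℕ} (σ : Fin m → ℕ) (i j : Fin m) : ℝ :=
  if σ j < σ i then 1 else if σ i = σ j then 0 else -1

/-- The head-to-head distance: half the `L¹` distance between head-to-head embeddings,
summing over pairs `i < j`. -/
noncomputable def dH {m : ℕ} (σ τ : Fin m → ℕ) : ℝ :=
  (1 / 2) * ∑ p ∈ Finset.univ.filter (fun p : Fin m × Fin m => p.1 < p.2),
    |hcoord σ p.1 p.2 - hcoord τ p.1 p.2|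

/-- The number of strong disagreements: pairs strictly ranked in opposite orders. -/
def strDis {m : ℕ} (σ τ : Fin m → ℕ) : ℕ :=
  (Finset.univ.filter (fun p : Fin m × Fin m => p.1 < p.2 ∧
    ((σ p.1 < σ p.2 ∧ τ p.2 < τ p.1) ∨ (σ p.2 < σ p.1 ∧ τ p.1 < τ p.2)))).card

/-- The number of weak disagreements: pairs tied by exactly one of the two ballots. -/
def wkDis {m : ℕ} (σ τ : Fin m → ℕ) : ℕ :=
  (Finset.univ.filter (fun p : Fin m × Fin m => p.1 < p.2 ∧
    ((σ p.1 = σ p.2 ∧ τ p.1 ≠ τ p.2) ∨ (σ p.1 ≠ σ p.2 ∧ τ p.1 = τ p.2)))).card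

/-- Two ballots differ by a neighbor swap: two listed candidates in consecutive
positions are exchanged and everything else is unchanged. -/
def SwapAdj (m : ℕ) (σ τ : Ballot m) : Prop :=
  ∃ a b : Fin m, a ≠ b ∧ σ.1 b = σ.1 a + 1 ∧
    (σ.1 b < m ∨ ∀ c, σ.1 c = m → c = b) ∧
    τ.1 a = σ.1 b ∧ τ.1 b = σ.1 a ∧ ∀ c, c ≠ a → c ≠ b → τ.1 c = σ.1 c

/-- Weighted adjacency in the ballot graph `𝒢_m`: neighbor swaps have weight `1`, and
an extension of a ballot of length `k-1` to one of length `k` (the new candidate being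
placed at position `k`) has weight `(m-k)/2`, in either direction. -/
def BallotAdjW (m : ℕ) (σ τ : Ballot m) (w : ℝ) : Prop :=
  (SwapAdj m σ τ ∧ w = 1) ∨
  (∃ c, σ.1 c = m ∧ τ.1 c < m ∧ (∀ i, i ≠ c → τ.1 i = σ.1 i) ∧
    w = ((m : ℝ) - (τ.1 c : ℝ)) / 2) ∨
  (∃ c, τ.1 c = m ∧ σ.1 c < m ∧ (∀ i, i ≠ c → σ.1 i = τ.1 i) ∧
    w = ((m : ℝ) - (σ.1 c : ℝ)) / 2)

/-- A general swap: two listed candidates occupying positions `p` and `p + k` are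
exchanged and everything else is unchanged.  Such an edge has weight `k`. -/
def ShortcutAdj (m : ℕ) (σ τ : Ballot m) (k : ℕ) : Prop :=
  1 ≤ k ∧ ∃ a b : Fin m, a ≠ b ∧ σ.1 b = σ.1 a + k ∧
    (σ.1 b < m ∨ ∀ c, σ.1 c = m → c = b) ∧
    τ.1 a = σ.1 b ∧ τ.1 b = σ.1 a ∧ ∀ c, c ≠ a → c ≠ b → τ.1 c = σ.1 c

/-- Weighted adjacency in the shortcut ballot graph `𝒢_m⁺`: all edges of `𝒢_m`,
together with general swap edges of weight `k`. -/
def ShortcutBallotAdjW (m : ℕ) (σ τ : Ballot m) (w : ℝ) : Prop :=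
  BallotAdjW m σ τ w ∨ ∃ k : ℕ, ShortcutAdj m σ τ k ∧ w = (k : ℝ)

/-- `ShortcutReach m σ τ c` holds when there is a finite edge-path from `σ` to `τ` in
the shortcut ballot graph `𝒢_m⁺` whose edge weights sum to `c`. -/
inductive ShortcutReach (m : ℕ) : Ballot m → Ballot m → ℝ → Prop
  | refl (σ : Ballot m) : ShortcutReach m σ σ 0
  | step {σ τ ρ : Ballot m} {w c : ℝ} :
      ShortcutBallotAdjW m σ τ w → ShortcutReach m τ ρ c → ShortcutReach m σ ρ (w + c)

/-- The path metric of the shortcut ballot graph `𝒢_m⁺`. -/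
noncomputable def shortcutGraphDist (m : ℕ) (σ τ : Ballot m) : ℝ :=
  sInf {c : ℝ | ShortcutReach m σ τ c}

/-! ### Edge weights are Borda distances -/

theorem dB_eq_sum_abs (m : ℕ) (σ τ : Fin m → ℕ) :
    dB m σ τ = (1 / 2) * ∑ i, |(σ i : ℝ) - τ i| := by
  unfold dB bordaEmb
  congr 1
  refine Finset.sum_congr rfl fun i _ => ?_
  rw [sub_sub_sub_cancel_left, abs_sub_comm]

theorem dB_self (m : ℕ) (σ : Fin m → ℕ) : dB m σ σ = 0 := by
  simp [dB_eq_sum_abs]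

theorem dB_comm (m : ℕ) (σ τ : Fin m → ℕ) : dB m σ τ = dB m τ σ := by
  simp only [dB_eq_sum_abs, abs_sub_comm]

theorem dB_nonneg (m : ℕ) (σ τ : Fin m → ℕ) : 0 ≤ dB m σ τ := by
  rw [dB_eq_sum_abs]
  positivity

theorem dB_triangle (m : ℕ) (σ ρ τ : Fin m → ℕ) :
    dB m σ τ ≤ dB m σ ρ + dB m ρ τ := by
  simp only [dB_eq_sum_abs, ← mul_add, ← Finset.sum_add_distrib]
  gcongr
  exact abs_sub_le _ _ _

/-- The Borda distance is additive through a coordinatewise intermediate point. -/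
theorem dB_add_of_between {m : ℕ} {σ ρ τ : Fin m → ℕ}
    (h : ∀ i, (σ i ≤ ρ i ∧ ρ i ≤ τ i) ∨ (τ i ≤ ρ i ∧ ρ i ≤ σ i)) :
    dB m σ ρ + dB m ρ τ = dB m σ τ := by
  simp only [dB_eq_sum_abs, ← mul_add, ← Finset.sum_add_distrib]
  congr 1
  refine Finset.sum_congr rfl fun i _ => ?_
  rcases h i with ⟨h₁, h₂⟩ | ⟨h₁, h₂⟩
  · have h₁ : (σ i : ℝ) ≤ ρ i := by exact_mod_cast h₁
    have h₂ : (ρ i : ℝ) ≤ τ i := by exact_mod_cast h₂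
    rw [abs_of_nonpos (by linarith), abs_of_nonpos (by linarith), abs_of_nonpos (by linarith)]
    ring
  · have h₁ : (τ i : ℝ) ≤ ρ i := by exact_mod_cast h₁
    have h₂ : (ρ i : ℝ) ≤ σ i := by exact_mod_cast h₂
    rw [abs_of_nonneg (by linarith), abs_of_nonneg (by linarith), abs_of_nonneg (by linarith)]
    ring

theorem dB_of_eq_off {m : ℕ} {σ τ : Fin m → ℕ} {c : Fin m} (hle : τ c ≤ σ c)
    (h : ∀ i, i ≠ c → τ i = σ i) : dB m σ τ = ((σ c : ℝ) - τ c) / 2 := by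
  have hle : (τ c : ℝ) ≤ σ c := by exact_mod_cast hle
  rw [dB_eq_sum_abs, Finset.sum_eq_single c (fun i _ hi => by simp [h i hi]) (by simp),
    abs_of_nonneg (by linarith)]
  ring

theorem SwapAdj.shortcutAdj {m : ℕ} {σ τ : Ballot m} (h : SwapAdj m σ τ) :
    ShortcutAdj m σ τ 1 :=
  ⟨le_rfl, h⟩

theorem ShortcutAdj.dB_eq {m : ℕ} {σ τ : Ballot m} {k : ℕ} (h : ShortcutAdj m σ τ k) :
    dB m σ.1 τ.1 = k := by
  obtain ⟨-, a, b, hab, hk, -, ha, hb, hc⟩ := h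
  rw [dB_eq_sum_abs, Finset.sum_eq_add a b hab (fun i _ hi => by simp [hc i hi.1 hi.2])
    (by simp) (by simp), ha, hb, hk]
  simp only [Nat.cast_add, sub_add_cancel_left, add_sub_cancel_left, abs_neg, Nat.abs_cast]
  ring

theorem ShortcutAdj.symm {m : ℕ} {σ τ : Ballot m} {k : ℕ} (h : ShortcutAdj m σ τ k) :
    ShortcutAdj m τ σ k := by
  obtain ⟨hk1, a, b, hab, hk, hm, ha, hb, hc⟩ := h
  have hbm := (σ.2.1 b).2
  refine ⟨hk1, b, a, hab.symm, by omega, ?_, ha.symm, hb.symm,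
    fun c hcb hca => (hc c hca hcb).symm⟩
  refine hm.imp (fun h => by omega) fun h c hcm => ?_
  by_contra hca
  by_cases hcb : c = b
  · subst hcb
    omega
  · exact hcb (h c (by rw [← hc c hca hcb, hcm]))

theorem ShortcutBallotAdjW.dB_eq {m : ℕ} {σ τ : Ballot m} {w : ℝ}
    (h : ShortcutBallotAdjW m σ τ w) : dB m σ.1 τ.1 = w := by
  obtain (⟨h, rfl⟩ | ⟨c, hc, hlt, ho, rfl⟩ | ⟨c, hc, hlt, ho, rfl⟩) | ⟨k, h, rfl⟩ := h
  · simpa using h.shortcutAdj.dB_eq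
  · rw [dB_of_eq_off (by omega) ho, hc]
  · rw [dB_comm, dB_of_eq_off (by omega) ho, hc]
  · exact h.dB_eq

theorem ShortcutBallotAdjW.half_le {m : ℕ} {σ τ : Ballot m} {w : ℝ}
    (h : ShortcutBallotAdjW m σ τ w) : 1 / 2 ≤ w := by
  obtain (⟨h, rfl⟩ | ⟨c, hc, hlt, ho, rfl⟩ | ⟨c, hc, hlt, ho, rfl⟩) | ⟨k, h, rfl⟩ := h
  · norm_num
  · have : (τ.1 c : ℝ) + 1 ≤ m := by exact_mod_cast hlt
    linarith
  · have : (σ.1 c : ℝ) + 1 ≤ m := by exact_mod_cast hlt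
    linarith
  · have : (1 : ℝ) ≤ k := by exact_mod_cast h.1
    linarith

theorem ShortcutBallotAdjW.symm {m : ℕ} {σ τ : Ballot m} {w : ℝ}
    (h : ShortcutBallotAdjW m σ τ w) : ShortcutBallotAdjW m τ σ w := by
  obtain (⟨h, rfl⟩ | h | h) | ⟨k, h, rfl⟩ := h
  · exact Or.inr ⟨1, h.shortcutAdj.symm, by simp⟩
  · exact Or.inl (Or.inr (Or.inr h))
  · exact Or.inl (Or.inr (Or.inl h))
  · exact Or.inr ⟨k, h.symm, rfl⟩

namespace ShortcutReach

variable {m : ℕ} {σ τ ρ : Ballot m} {c w : ℝ}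

theorem dB_le (h : ShortcutReach m σ τ c) : dB m σ.1 τ.1 ≤ c := by
  induction h with
  | refl σ => rw [dB_self]
  | @step _ τ _ _ _ hw _ ih =>
    refine (dB_triangle m _ τ.1 _).trans ?_
    rw [hw.dB_eq]
    gcongr

theorem snoc (h : ShortcutReach m σ τ c) (hw : ShortcutBallotAdjW m τ ρ w) :
    ShortcutReach m σ ρ (c + w) := by
  induction h with
  | refl σ => simpa [add_comm] using step hw (refl ρ)
  | step hv _ ih => simpa [add_assoc] using step hv (ih hw)

theorem symm (h : ShortcutReach m σ τ c) : ShortcutReach m τ σ c := by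
  induction h with
  | refl σ => exact refl σ
  | step hw _ ih => simpa [add_comm] using ih.snoc hw.symm

end ShortcutReach

/-! ### Edges along which the Borda distance to a target decreases by the edge weight -/

theorem IsBallot.comp_perm {m : ℕ} {σ : Fin m → ℕ} (h : IsBallot m σ)
    (e : Equiv.Perm (Fin m)) : IsBallot m (σ ∘ e) := by
  refine ⟨fun i => h.1 (e i), fun i i' hi hii => e.injective (h.2.1 _ _ hi hii),
    fun i j hj hji hi => ?_⟩
  obtain ⟨i', hi'⟩ := h.2.2 _ j hj hji hi
  exact ⟨e.symm i', by simpa using hi'⟩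

/-- The listed candidates of a ballot occupy exactly the positions `1, …, l`. -/
theorem IsBallot.exists_length {m : ℕ} {σ : Fin m → ℕ} (h : IsBallot m σ) (hm : 0 < m) :
    ∃ l < m, (∀ i, σ i < m → σ i ≤ l) ∧ ∀ j, 1 ≤ j → j ≤ l → ∃ i, σ i = j := by
  classical
  have hex : ∃ l, l + 1 = m ∨ ∀ i, σ i ≠ l + 1 := ⟨m - 1, Or.inl (by omega)⟩
  refine ⟨Nat.find hex, ?_, fun i hi => ?_, fun j hj hjl => ?_⟩
  · have := Nat.find_min' hex (m := m - 1) (Or.inl (by omega))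
    omega
  · by_contra! hlt
    rcases Nat.find_spec hex with heq | hne
    · omega
    · obtain ⟨i', hi'⟩ := h.2.2 i (Nat.find hex + 1) (by omega) hlt hi
      exact hne i' hi'
  · have := Nat.find_min hex (m := j - 1) (by omega)
    push Not at this
    obtain ⟨i, hi⟩ := this.2
    exact ⟨i, by omega⟩

theorem IsBallot.update {m l : ℕ} {σ : Fin m → ℕ} (h : IsBallot m σ) (hl : l + 1 < m)
    (hle : ∀ i, σ i < m → σ i ≤ l) (hsurj : ∀ j, 1 ≤ j → j ≤ l → ∃ i, σ i = j)
    {c : Fin m} (hc : σ c = m) : IsBallot m (Function.update σ c (l + 1)) := by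
  have hself : Function.update σ c (l + 1) c = l + 1 := Function.update_self ..
  have hother : ∀ i, i ≠ c → Function.update σ c (l + 1) i = σ i := fun i hi =>
    Function.update_of_ne hi ..
  have hlel : ∀ i, Function.update σ c (l + 1) i < m →
      Function.update σ c (l + 1) i ≤ l + 1 := fun i hi => by
    by_cases hic : i = c
    · rw [hic, hself]
    · rw [hother i hic] at hi ⊢
      exact (hle i hi).trans (Nat.le_succ l)
  refine ⟨fun i => ?_, fun i i' hi hii => ?_, fun i j hj hji hi => ?_⟩
  · by_cases hic : i = c
    · rw [hic, hself]
      omega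
    · rw [hother i hic]
      exact h.1 i
  · by_cases hic : i = c <;> by_cases hic' : i' = c
    · rw [hic, hic']
    · subst hic
      rw [hself, hother i' hic'] at hii
      have := hle i'
      omega
    · subst hic'
      rw [hself, hother i hic] at hii
      have := hle i
      omega
    · rw [hother i hic, hother i' hic'] at hii
      rw [hother i hic] at hi
      exact h.2.1 i i' hi hii
  · have hjl := hji.trans (hlel i hi)
    rcases hjl.eq_or_lt with rfl | hlt
    · exact ⟨c, hself⟩
    · obtain ⟨i', hi'⟩ := hsurj j hj (by omega)
      refine ⟨i', ?_⟩
      rw [hother i' (by rintro rfl; omega), hi']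

/-- A ballot all of whose positions `1, …, m - 1` are occupied is a full ranking. -/
theorem IsBallot.injective_of_length {m : ℕ} {σ : Fin m → ℕ} (h : IsBallot m σ)
    (hsurj : ∀ j, 1 ≤ j → j < m → ∃ i, σ i = j) :
    (∀ i i', σ i = σ i' → i = i') ∧ ∀ j, 1 ≤ j → j ≤ m → ∃ i, σ i = j := by
  have hmaps : ∀ i ∈ (Finset.univ : Finset (Fin m)), σ i ∈ Finset.Icc 1 m := fun i _ =>
    Finset.mem_Icc.2 (h.1 i)
  have hall : ∀ j, 1 ≤ j → j ≤ m → ∃ i, σ i = j := by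
    intro j hj hjm
    rcases hjm.lt_or_eq with hlt | rfl
    · exact hsurj j hj hlt
    · by_contra! hne
      have hlt : ∀ i, σ i < j := fun i => lt_of_le_of_ne (h.1 i).2 (hne i)
      obtain ⟨i, -, i', -, hii, heq⟩ :=
        Finset.exists_ne_map_eq_of_card_lt_of_maps_to (s := Finset.univ)
          (t := Finset.Icc 1 (j - 1)) (f := σ) (by simp; omega)
          (fun i _ => by
            have := hlt i
            have := h.1 i
            simp only [Finset.coe_Icc, Set.mem_Icc]
            omega)
      exact hii (h.2.1 i i' (hlt i) heq)
  refine ⟨fun i i' hii => ?_, hall⟩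
  refine Finset.inj_on_of_surj_on_of_card_le (s := Finset.univ) (t := Finset.Icc 1 m)
    (fun i _ => σ i) hmaps (fun j hj => ?_) (by simp) (Finset.mem_univ i)
    (Finset.mem_univ i') hii
  obtain ⟨i, hi⟩ := hall j (Finset.mem_Icc.1 hj).1 (Finset.mem_Icc.1 hj).2
  exact ⟨i, Finset.mem_univ i, hi⟩

/-- There is an edge starting at `σ` which lies on a shortest path towards `τ`. -/
def HasGeodesicStep (m : ℕ) (σ τ : Ballot m) : Prop :=
  ∃ (ρ : Ballot m) (w : ℝ), ShortcutBallotAdjW m σ ρ w ∧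
    ∀ i, (σ.1 i ≤ ρ.1 i ∧ ρ.1 i ≤ τ.1 i) ∨ (τ.1 i ≤ ρ.1 i ∧ ρ.1 i ≤ σ.1 i)

theorem hasGeodesicStep_of_extend {m l : ℕ} {σ τ : Ballot m} (hl : l + 1 < m)
    (hle : ∀ i, σ.1 i < m → σ.1 i ≤ l) (hsurj : ∀ j, 1 ≤ j → j ≤ l → ∃ i, σ.1 i = j)
    {c : Fin m} (hc : σ.1 c = m) (hτc : τ.1 c ≤ l + 1) : HasGeodesicStep m σ τ := by
  refine ⟨⟨Function.update σ.1 c (l + 1), σ.2.update hl hle hsurj hc⟩,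
    ((m : ℝ) - ((l + 1 : ℕ) : ℝ)) / 2, Or.inl (Or.inr (Or.inl ⟨c, hc, ?_, ?_, ?_⟩)),
    fun i => ?_⟩
  · simpa using hl
  · intro i hi
    simp [hi]
  · simp
  · by_cases hi : i = c
    · subst hi
      simp only [Function.update_self]
      omega
    · simp only [Function.update_of_ne hi]
      omega

theorem hasGeodesicStep_of_swap {m : ℕ} {σ τ : Ballot m} {a b : Fin m}
    (hab : σ.1 a < σ.1 b) (hbτ : σ.1 b ≤ τ.1 a) (hτb : τ.1 b ≤ σ.1 a)
    (hm : σ.1 b < m ∨ ∀ c, σ.1 c = m → c = b) : HasGeodesicStep m σ τ := by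
  have hne : a ≠ b := by
    rintro rfl
    omega
  refine ⟨⟨σ.1 ∘ Equiv.swap a b, σ.2.comp_perm _⟩, ((σ.1 b - σ.1 a : ℕ) : ℝ),
    Or.inr ⟨_, ⟨by omega, a, b, hne, by omega, hm, by simp, by simp, fun c hca hcb => ?_⟩, rfl⟩,
    fun i => ?_⟩
  · simp [Equiv.swap_apply_of_ne_of_ne hca hcb]
  · by_cases hia : i = a
    · subst hia
      simp only [Function.comp_apply, Equiv.swap_apply_left]
      omega
    · by_cases hib : i = b
      · subst hib
        simp only [Function.comp_apply, Equiv.swap_apply_right]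
        omega
      · simp only [Function.comp_apply, Equiv.swap_apply_of_ne_of_ne hia hib]
        omega

/-- If `σ` and `τ` agree outside the candidates in positions `1, …, K`, which they both rank
bijectively, and some candidate moves down, then some swap is a step of a shortest path. -/
theorem hasGeodesicStep_of_lt {m K : ℕ} {σ τ : Ballot m}
    (hσ : ∀ i i', σ.1 i ≤ K → σ.1 i = σ.1 i' → i = i')
    (hτ : ∀ i i', τ.1 i ≤ K → τ.1 i = τ.1 i' → i = i')
    (hsurj : ∀ j, 1 ≤ j → j ≤ K → ∃ i, σ.1 i = j)
    (hK : ∀ i, σ.1 i < τ.1 i → τ.1 i ≤ K)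
    {a₀ : Fin m} (ha₀ : σ.1 a₀ < τ.1 a₀) : HasGeodesicStep m σ τ := by
  obtain ⟨a, ha, hmax⟩ := Finset.exists_max_image
    (Finset.univ.filter fun i => σ.1 i < τ.1 i) σ.1 ⟨a₀, by simpa using ha₀⟩
  simp only [Finset.mem_filter, Finset.mem_univ, true_and] at ha hmax
  have hdown : ∀ b, σ.1 a < σ.1 b → τ.1 b ≤ σ.1 b := fun b hb => by
    by_contra! h
    have := hmax b h
    omega
  have haK := hK a ha
  obtain ⟨b, hab, hbτ, hτb⟩ : ∃ b, σ.1 a < σ.1 b ∧ σ.1 b ≤ τ.1 a ∧ τ.1 b ≤ σ.1 a := by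
    by_contra! hno
    have : Nonempty (Fin m) := ⟨a⟩
    choose! g hg using hsurj
    have hga : ∀ j ∈ Finset.Ioc (σ.1 a) (τ.1 a), σ.1 (g j) = j := fun j hj => by
      rw [Finset.mem_Ioc] at hj
      exact hg j (by omega) (by omega)
    let h : ℕ → Fin m := fun j => if j = σ.1 a then a else g j
    have hσh : ∀ j ∈ Finset.Icc (σ.1 a) (τ.1 a), σ.1 (h j) = j := fun j hj => by
      rw [Finset.mem_Icc] at hj
      by_cases hja : j = σ.1 a
      · simp [h, hja]
      · simp only [h, hja, if_false]
        exact hga j (Finset.mem_Ioc.2 (by omega))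
    have hτh : ∀ j ∈ Finset.Icc (σ.1 a) (τ.1 a), σ.1 a < τ.1 (h j) ∧ τ.1 (h j) ≤ τ.1 a := by
      intro j hj
      have hj' := hσh j hj
      rw [Finset.mem_Icc] at hj
      by_cases hja : j = σ.1 a
      · simp [h, hja, ha]
      · have h1 := hno (h j) (by omega) (by omega)
        have h2 := hdown (h j) (by omega)
        omega
    obtain ⟨j, hj, j', hj', hne, heq⟩ :=
      Finset.exists_ne_map_eq_of_card_lt_of_maps_to (s := Finset.Icc (σ.1 a) (τ.1 a))
        (t := Finset.Ioc (σ.1 a) (τ.1 a)) (f := fun j => τ.1 (h j))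
        (by simp only [Nat.card_Icc, Nat.card_Ioc]; omega)
        (fun j hj => Finset.mem_coe.2 (Finset.mem_Ioc.2 (hτh j hj)))
    have := hτ _ _ ((hτh j hj).2.trans haK) heq
    exact hne (by rw [← hσh j hj, ← hσh j' hj', this])
  refine hasGeodesicStep_of_swap hab hbτ hτb ?_
  by_cases hbm : σ.1 b < m
  · exact Or.inl hbm
  · refine Or.inr fun c hc => ?_
    have := (σ.2.1 b).2
    exact (hσ b c (hbτ.trans haK) (by omega)).symm

theorem exists_extend_of_length_lt {m l l' : ℕ} {σ τ : Fin m → ℕ}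
    (hσ : IsBallot m σ) (hl' : l' < m) (hlt : l < l')
    (hle : ∀ i, σ i < m → σ i ≤ l) (hsurj : ∀ j, 1 ≤ j → j ≤ l' → ∃ i, τ i = j) :
    ∃ c, σ c = m ∧ τ c ≤ l + 1 := by
  by_contra! hno
  have : Nonempty (Fin m) := ⟨⟨l', hl'⟩⟩
  choose! g hg using hsurj
  have hg' : ∀ j ∈ Finset.Icc 1 (l + 1), τ (g j) = j ∧ σ (g j) < m := fun j hj => by
    rw [Finset.mem_Icc] at hj
    have h1 := hg j hj.1 (by omega)
    refine ⟨h1, lt_of_le_of_ne (hσ.1 _).2 fun h => ?_⟩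
    have := hno _ h
    omega
  obtain ⟨j, hj, j', hj', hne, heq⟩ :=
    Finset.exists_ne_map_eq_of_card_lt_of_maps_to (s := Finset.Icc 1 (l + 1))
      (t := Finset.Icc 1 l) (f := fun j => σ (g j)) (by simp)
      (fun j hj => Finset.mem_coe.2 (Finset.mem_Icc.2
        ⟨(hσ.1 _).1, hle _ (hg' j hj).2⟩))
  have := hσ.2.1 _ _ (hg' j hj).2 heq
  exact hne (by rw [← (hg' j hj).1, ← (hg' j' hj').1, this])

theorem hasGeodesicStep_or {m : ℕ} {σ τ : Ballot m} (hne : σ ≠ τ) :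
    HasGeodesicStep m σ τ ∨ HasGeodesicStep m τ σ := by
  obtain ⟨i₀, hi₀⟩ : ∃ i, σ.1 i ≠ τ.1 i := by
    by_contra! h
    exact hne (Subtype.ext (funext h))
  have hm : 0 < m := i₀.pos
  obtain ⟨l, hl, hle, hsurj⟩ := σ.2.exists_length hm
  obtain ⟨l', hl', hle', hsurj'⟩ := τ.2.exists_length hm
  rcases lt_trichotomy l l' with hlt | rfl | hlt
  · obtain ⟨c, hc, hc'⟩ := exists_extend_of_length_lt σ.2 hl' hlt hle hsurj'
    exact Or.inl (hasGeodesicStep_of_extend (by omega) hle hsurj hc hc')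
  · by_cases hfull : l + 1 = m
    · obtain ⟨hinj, hall⟩ := σ.2.injective_of_length fun j hj hjm => hsurj j hj (by omega)
      obtain ⟨hinj', hall'⟩ := τ.2.injective_of_length fun j hj hjm => hsurj' j hj (by omega)
      rcases hi₀.lt_or_gt with h | h
      · exact Or.inl (hasGeodesicStep_of_lt (fun i i' _ => hinj i i') (fun i i' _ => hinj' i i')
          hall (fun i _ => (τ.2.1 i).2) h)
      · exact Or.inr (hasGeodesicStep_of_lt (fun i i' _ => hinj' i i') (fun i i' _ => hinj i i')
          hall' (fun i _ => (σ.2.1 i).2) h)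
    · by_cases h1 : ∃ c, σ.1 c = m ∧ τ.1 c < m
      · obtain ⟨c, hc, hc'⟩ := h1
        exact Or.inl (hasGeodesicStep_of_extend (by omega) hle hsurj hc
          ((hle' c hc').trans (Nat.le_succ l)))
      by_cases h2 : ∃ c, τ.1 c = m ∧ σ.1 c < m
      · obtain ⟨c, hc, hc'⟩ := h2
        exact Or.inr (hasGeodesicStep_of_extend (by omega) hle' hsurj' hc
          ((hle c hc').trans (Nat.le_succ l)))
      push Not at h1 h2
      have hinj : ∀ i i', σ.1 i ≤ l → σ.1 i = σ.1 i' → i = i' := fun i i' hi =>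
        σ.2.2.1 i i' (by omega)
      have hinj' : ∀ i i', τ.1 i ≤ l → τ.1 i = τ.1 i' → i = i' := fun i i' hi =>
        τ.2.2.1 i i' (by omega)
      rcases hi₀.lt_or_gt with h | h
      · refine Or.inl (hasGeodesicStep_of_lt hinj hinj' hsurj (fun i hi => hle' i ?_) h)
        have := (τ.2.1 i).2
        have := h2 i
        omega
      · refine Or.inr (hasGeodesicStep_of_lt hinj' hinj hsurj' (fun i hi => hle i ?_) h)
        have := (σ.2.1 i).2
        have := h1 i
        omega
  · obtain ⟨c, hc, hc'⟩ := exists_extend_of_length_lt τ.2 hl hlt hle' hsurj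
    exact Or.inr (hasGeodesicStep_of_extend (by omega) hle' hsurj' hc hc')

theorem shortcutReach_dB_of_lt {m : ℕ} (n : ℕ) (σ τ : Ballot m) (hn : 2 * dB m σ.1 τ.1 < n) :
    ShortcutReach m σ τ (dB m σ.1 τ.1) := by
  induction n generalizing σ τ with
  | zero =>
    have := dB_nonneg m σ.1 τ.1
    rw [Nat.cast_zero] at hn
    linarith
  | succ n ih =>
    have key : ∀ σ τ : Ballot m, 2 * dB m σ.1 τ.1 < (n + 1 : ℕ) → HasGeodesicStep m σ τ →
        ShortcutReach m σ τ (dB m σ.1 τ.1) := by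
      rintro σ τ hn ⟨ρ, w, hw, hb⟩
      have hadd := dB_add_of_between hb
      rw [hw.dB_eq] at hadd
      rw [← hadd]
      refine .step hw (ih ρ τ ?_)
      have := hw.half_le
      push_cast at hn
      linarith
    by_cases hne : σ = τ
    · subst hne
      rw [dB_self]
      exact .refl σ
    · rcases hasGeodesicStep_or hne with h | h
      · exact key σ τ hn h
      · rw [dB_comm] at hn ⊢
        exact (key τ σ hn h).symm

/-- For all partial ballots `σ, τ` on `m` candidates, the path-metric
distance between `σ` and `τ` in the shortcut ballot graph `𝒢_m⁺` equals `d_B(σ,τ)`. -/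
theorem shortcutGraphDist_eq_dB (m : ℕ) (σ τ : Ballot m) :
    shortcutGraphDist m σ τ = dB m σ.1 τ.1 := by
  obtain ⟨n, hn⟩ := exists_nat_gt (2 * dB m σ.1 τ.1)
  exact IsLeast.csInf_eq ⟨shortcutReach_dB_of_lt n σ τ hn, fun _ h => h.dB_le⟩
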